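/- Let β ≥ 0, λ ≥ β, let a : ℝ → [0,1] with √a κ-Lipschitz, V : ℝ → [0,1] κ-Lipschitz, and G ∈ 𝒢_sqc. Let I be an open interval of ℝ such that a > 0 on I and a = 0 on ∂I when this set is nonempty. If u₁, u₂ ∈ 𝒮^λ_+ (respectively, u₁, u₂ ∈ 𝒮^λ_−), then u₁'(x) = u₂'(x) for almost every x ∈ I. -/

import Mathlib

open Real Set MeasureTheory

noncomputable section

/-- The class 𝒢(α₀,α₁,γ): growth condition (G1) and local Lipschitz condition (G2). -/
def MemG (α₀ α₁ γ : ℝ) (G : ℝ → ℝ) : Prop :=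
  (∀ p : ℝ, α₀ * |p| ^ γ - 1 / α₀ ≤ G p ∧ G p ≤ α₁ * (|p| ^ γ + 1)) ∧
  (∀ p q : ℝ, |G p - G q| ≤ α₁ * (|p| + |q| + 1) ^ (γ - 1) * |p - q|)

/-- The class 𝒢: union of the classes 𝒢(α₀,α₁,γ). -/
def MemGclass (G : ℝ → ℝ) : Prop :=
  ∃ α₀ α₁ γ : ℝ, 0 < α₀ ∧ 0 < α₁ ∧ 1 < γ ∧ MemG α₀ α₁ γ G

/-- Condition (G4): strict monotonicity with rate η on both half-lines. -/
def StrictIncrRate (G : ℝ → ℝ) (η : ℝ) : Prop :=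
  ∀ p₁ p₂ : ℝ, 0 ≤ p₁ → p₁ < p₂ →
    η * (p₂ - p₁) ≤ G p₂ - G p₁ ∧ η * (p₂ - p₁) ≤ G (-p₂) - G (-p₁)

/-- The class 𝒢_sqc: G ∈ 𝒢, G(0) = 0 and (G4) for some η > 0. -/
def MemGsqc (G : ℝ → ℝ) : Prop :=
  MemGclass G ∧ G 0 = 0 ∧ ∃ η : ℝ, 0 < η ∧ StrictIncrRate G η

/-- G_+^{-1} : the inverse of the restriction of G to [0,∞). -/
def GplusInv (G : ℝ → ℝ) (y : ℝ) : ℝ := Function.invFunOn G (Set.Ici 0) y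

/-- G_−^{-1} : the inverse of the restriction of G to (−∞,0]. -/
def GminusInv (G : ℝ → ℝ) (y : ℝ) : ℝ := Function.invFunOn G (Set.Iic 0) y

/-- Viscosity subsolution of a(x)u'' + G(u') + βV(x) = λ on ℝ. -/
def IsViscSubsol (a V G : ℝ → ℝ) (β lam : ℝ) (u : ℝ → ℝ) : Prop :=
  ∀ x₀ : ℝ, ∀ φ : ℝ → ℝ, ContDiff ℝ 2 φ →
    IsLocalMax (fun x => u x - φ x) x₀ →
    lam ≤ a x₀ * deriv (deriv φ) x₀ + G (deriv φ x₀) + β * V x₀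

/-- Viscosity supersolution of a(x)u'' + G(u') + βV(x) = λ on ℝ. -/
def IsViscSupersol (a V G : ℝ → ℝ) (β lam : ℝ) (u : ℝ → ℝ) : Prop :=
  ∀ x₀ : ℝ, ∀ φ : ℝ → ℝ, ContDiff ℝ 2 φ →
    IsLocalMin (fun x => u x - φ x) x₀ →
    a x₀ * deriv (deriv φ) x₀ + G (deriv φ x₀) + β * V x₀ ≤ lam

/-- Continuous viscosity solution of a(x)u'' + G(u') + βV(x) = λ on ℝ. -/
def IsViscSol (a V G : ℝ → ℝ) (β lam : ℝ) (u : ℝ → ℝ) : Prop :=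
  Continuous u ∧ IsViscSubsol a V G β lam u ∧ IsViscSupersol a V G β lam u

/-- The set 𝒮^λ_+ of Lipschitz viscosity solutions with
u'(x) ∈ [G_+^{-1}(λ−β), G_+^{-1}(λ)] for a.e. x ∈ ℝ. -/
def Splus (a V G : ℝ → ℝ) (β lam : ℝ) : Set (ℝ → ℝ) :=
  {u | (∃ K : NNReal, LipschitzWith K u) ∧ IsViscSol a V G β lam u ∧
    ∀ᵐ x ∂(volume : Measure ℝ),
      deriv u x ∈ Set.Icc (GplusInv G (lam - β)) (GplusInv G lam)}

/-- The set 𝒮^λ_− of Lipschitz viscosity solutions with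
u'(x) ∈ [G_−^{-1}(λ), G_−^{-1}(λ−β)] for a.e. x ∈ ℝ. -/
def Sminus (a V G : ℝ → ℝ) (β lam : ℝ) : Set (ℝ → ℝ) :=
  {u | (∃ K : NNReal, LipschitzWith K u) ∧ IsViscSol a V G β lam u ∧
    ∀ᵐ x ∂(volume : Measure ℝ),
      deriv u x ∈ Set.Icc (GminusInv G lam) (GminusInv G (lam - β))}

open Filter Topology

lemma sq_mul_le_sq_mul_of_ae_deriv_le {w E a : ℝ → ℝ} {x y c : ℝ} {L : NNReal} (hxy : x ≤ y)
    (hw : LipschitzOnWith L w (Icc x y)) (hE : ContDiffOn ℝ 1 E (Icc x y))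
    (hE0 : ∀ t ∈ Icc x y, 0 ≤ E t) (ha : ∀ t ∈ Ioo x y, 0 < a t)
    (hEd : ∀ t ∈ Ioo x y, a t * deriv E t ≤ 2 * c * E t)
    (hae : ∀ᵐ t, t ∈ Ioo x y → a t * (w t * deriv w t) ≤ -c * w t ^ 2) :
    w y ^ 2 * E y ≤ w x ^ 2 * E x := by
  have hw' : AbsolutelyContinuousOnInterval w x y :=
    LipschitzOnWith.absolutelyContinuousOnInterval (K := L) (by rwa [uIcc_of_le hxy])
  have hE' : AbsolutelyContinuousOnInterval E x y :=
    ContDiffOn.absolutelyContinuousOnInterval (by rwa [uIcc_of_le hxy])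
  have hF := (hw'.mul hw').mul hE'
  have hint := hF.integral_deriv_eq_sub
  have hneg : ∫ t in x..y, deriv (w * w * E) t ≤ 0 := by
    rw [intervalIntegral.integral_of_le hxy, integral_Ioc_eq_integral_Ioo]
    apply integral_nonpos_of_ae
    rw [Filter.EventuallyLE, ae_restrict_iff' measurableSet_Ioo]
    filter_upwards [hae, hw'.ae_differentiableAt] with t ht hd hmem
    have hmem' : t ∈ Icc x y := Ioo_subset_Icc_self hmem
    have hdw := (hd (by rwa [uIcc_of_le hxy])).hasDerivAt
    have hdE : HasDerivAt E (deriv E t) t :=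
      ((hE.contDiffAt (Icc_mem_nhds hmem.1 hmem.2)).differentiableAt (by norm_num)).hasDerivAt
    have := ((hdw.mul hdw).mul hdE).deriv
    rw [this]
    have h1 := ht hmem
    have h2 := hEd t hmem
    have h3 := hE0 t hmem'
    have ha' := ha t hmem
    have key : a t * ((deriv w t * w t + w t * deriv w t) * E t + (w * w) t * deriv E t) ≤ 0 := by
      simp only [Pi.mul_apply]
      nlinarith [mul_le_mul_of_nonneg_right h1 h3, mul_le_mul_of_nonneg_left h2 (sq_nonneg (w t))]
    simp only [Pi.zero_apply]
    by_contra! hcon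
    exact absurd key (not_le.mpr (mul_pos ha' hcon))
  rw [hint] at hneg
  simp only [Pi.mul_apply] at hneg
  nlinarith

lemma eq_zero_of_ae_deriv_le {I : Set ℝ} (hI : IsOpen I) (hI_conn : I.OrdConnected)
    {a w : ℝ → ℝ} {κ c M : ℝ} (hκ : 0 < κ) (hc : 0 < c)
    (ha_range : ∀ x, a x ∈ Set.Icc (0 : ℝ) 1)
    (ha_lip : LipschitzWith (Real.toNNReal κ) (fun x => Real.sqrt (a x)))
    (ha_pos : ∀ x ∈ I, 0 < a x) (ha_bdry : ∀ x ∈ frontier I, a x = 0)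
    (hM : ∀ x ∈ I, w x ^ 2 ≤ M)
    (hw : ∀ x ∈ I, ∀ y ∈ I, ∃ L, LipschitzOnWith L w (Icc x y))
    (hae : ∀ᵐ t, t ∈ I → a t * (w t * deriv w t) ≤ -c * w t ^ 2) :
    ∀ y ∈ I, w y = 0 := by
  intro y hy
  have step : ∀ E : ℝ → ℝ, ∀ x ∈ I, x ≤ y → ContDiffOn ℝ 1 E (Icc x y) →
      (∀ t ∈ Icc x y, 0 ≤ E t) → (∀ t ∈ Ioo x y, a t * deriv E t ≤ 2 * c * E t) →
      w y ^ 2 * E y ≤ M * E x := by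
    intro E x hx hxy hE hE0 hEd
    obtain ⟨L, hL⟩ := hw x hx y hy
    have hsub : Ioo x y ⊆ I := Ioo_subset_Icc_self.trans (hI_conn.out hx hy)
    have h1 := sq_mul_le_sq_mul_of_ae_deriv_le hxy hL hE hE0 (fun t ht => ha_pos t (hsub ht)) hEd
      (by filter_upwards [hae] with t ht hmem using ht (hsub hmem))
    exact h1.trans (mul_le_mul_of_nonneg_right (hM x hx) (hE0 x (left_mem_Icc.2 hxy)))
  have finish : ∀ e : ℝ, 0 < e → w y ^ 2 * e ≤ 0 → w y = 0 := by
    intro e he h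
    have : w y ^ 2 ≤ 0 := by by_contra! h'; exact absurd h (not_le.2 (mul_pos h' he))
    exact pow_eq_zero_iff two_ne_zero |>.1 (le_antisymm this (sq_nonneg _))
  by_cases hb : BddBelow I
  · set l := sInf I with hl
    have hlc : l ∈ closure I := csInf_mem_closure ⟨y, hy⟩ hb
    have hl_not : l ∉ I := by
      intro h
      obtain ⟨x, hx, hxI⟩ := (mem_nhdsLT_iff_exists_Ioo_subset.1
        (mem_nhdsWithin_of_mem_nhds (hI.mem_nhds h)))
      obtain ⟨z, hz⟩ := exists_between (mem_Iio.1 hx)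
      exact absurd (csInf_le hb (hxI hz)) (not_le.2 hz.2)
    have hly : l < y := lt_of_le_of_ne (csInf_le hb hy) (fun h => hl_not (h ▸ hy))
    have hmem : ∀ x ∈ Ioo l y, x ∈ I := by
      intro x hx
      obtain ⟨z, hz, hzx⟩ := exists_lt_of_csInf_lt ⟨y, hy⟩ hx.1
      exact hI_conn.out hz hy ⟨hzx.le, hx.2.le⟩
    have hal : a l = 0 := ha_bdry l ⟨hlc, by rwa [hI.interior_eq]⟩
    have ha_le : ∀ t, a t ≤ κ ^ 2 * (t - l) ^ 2 := by
      intro t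
      have h1 := ha_lip.dist_le_mul t l
      rw [Real.dist_eq, Real.dist_eq, hal, Real.sqrt_zero, sub_zero,
        abs_of_nonneg (Real.sqrt_nonneg _), Real.coe_toNNReal _ hκ.le] at h1
      have h2 := Real.sq_sqrt (ha_range t).1
      calc a t = √(a t) ^ 2 := h2.symm
        _ ≤ (κ * |t - l|) ^ 2 := pow_le_pow_left₀ (Real.sqrt_nonneg _) h1 2
        _ = κ ^ 2 * (t - l) ^ 2 := by rw [mul_pow, sq_abs]
    set k := 2 * c / κ ^ 2 with hk
    have hkpos : 0 < k := by positivity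
    set E : ℝ → ℝ := fun t => Real.exp (-(k * (t - l)⁻¹)) with hEdef
    have hlim : Tendsto (fun x => M * E x) (𝓝[>] l) (𝓝 (M * 0)) := by
      apply Tendsto.const_mul
      apply Real.tendsto_exp_neg_atTop_nhds_zero.comp
      apply Tendsto.const_mul_atTop hkpos
      apply tendsto_inv_nhdsGT_zero.comp
      apply tendsto_nhdsWithin_iff.2 ⟨?_, ?_⟩
      · have : Tendsto (fun x => x - l) (𝓝 l) (𝓝 (l - l)) := tendsto_id.sub_const l
        rw [sub_self] at this
        exact this.mono_left nhdsWithin_le_nhds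
      · filter_upwards [self_mem_nhdsWithin] with x hx using sub_pos.2 (mem_Ioi.1 hx)
    apply finish (E y) (Real.exp_pos _)
    rw [mul_zero] at hlim
    apply ge_of_tendsto hlim
    filter_upwards [Ioo_mem_nhdsGT hly] with x hx
    refine step E x (hmem x hx) hx.2.le ?_ (fun t _ => (Real.exp_pos _).le) ?_
    · have : ∀ t ∈ Icc x y, t - l ≠ 0 := fun t ht => (sub_pos.2 (hx.1.trans_le ht.1)).ne'
      exact ((contDiffOn_const.mul ((contDiffOn_id.sub contDiffOn_const).inv this)).neg).exp
    · intro t ht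
      have htl : 0 < t - l := sub_pos.2 (hx.1.trans ht.1)
      have hd : HasDerivAt E (Real.exp (-(k * (t - l)⁻¹)) * (-(k * (-1 / (t - l) ^ 2)))) t :=
        (((((hasDerivAt_id t).sub_const l).inv htl.ne').const_mul k).neg).exp
      rw [hd.deriv]
      have h1 : a t * (k * (1 / (t - l) ^ 2)) ≤ 2 * c := by
        calc a t * (k * (1 / (t - l) ^ 2))
            ≤ (κ ^ 2 * (t - l) ^ 2) * (k * (1 / (t - l) ^ 2)) := by gcongr; exact ha_le t
          _ = 2 * c := by rw [hk]; field_simp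
      calc _ = a t * (k * (1 / (t - l) ^ 2)) * E t := by simp only [hEdef]; ring
        _ ≤ _ := mul_le_mul_of_nonneg_right h1 (Real.exp_pos _).le
  · have hmem : ∀ x ≤ y, x ∈ I := by
      intro x hx
      obtain ⟨z, hz, hzx⟩ := not_bddBelow_iff.1 hb x
      exact hI_conn.out hz hy ⟨hzx.le, hx⟩
    have hlim : Tendsto (fun x => M * Real.exp (2 * c * x)) atBot (𝓝 (M * 0)) := by
      apply Tendsto.const_mul
      exact Real.tendsto_exp_atBot.comp (tendsto_id.const_mul_atBot (by positivity))
    apply finish (Real.exp (2 * c * y)) (Real.exp_pos _)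
    rw [mul_zero] at hlim
    apply ge_of_tendsto hlim
    filter_upwards [Iic_mem_atBot y] with x hx
    refine step (fun t => Real.exp (2 * c * t)) x (hmem x hx) hx ?_
      (fun t _ => (Real.exp_pos _).le) ?_
    · exact (contDiff_const.mul contDiff_id).exp.contDiffOn
    · intro t _
      have hd : HasDerivAt (fun t => Real.exp (2 * c * t)) (Real.exp (2 * c * t) * (2 * c * 1)) t :=
        ((hasDerivAt_id t).const_mul (2 * c)).exp
      rw [hd.deriv]
      have h1 := (ha_range t).2
      have h2 := Real.exp_pos (2 * c * t)
      have : 0 < Real.exp (2 * c * t) * (2 * c * 1) := by positivity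
      nlinarith [mul_le_mul_of_nonneg_right h1 this.le]

lemma eq_zero_of_ae_le_deriv {I : Set ℝ} (hI : IsOpen I) (hI_conn : I.OrdConnected)
    {a w : ℝ → ℝ} {κ c M : ℝ} (hκ : 0 < κ) (hc : 0 < c)
    (ha_range : ∀ x, a x ∈ Set.Icc (0 : ℝ) 1)
    (ha_lip : LipschitzWith (Real.toNNReal κ) (fun x => Real.sqrt (a x)))
    (ha_pos : ∀ x ∈ I, 0 < a x) (ha_bdry : ∀ x ∈ frontier I, a x = 0)
    (hM : ∀ x ∈ I, w x ^ 2 ≤ M)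
    (hw : ∀ x ∈ I, ∀ y ∈ I, ∃ L, LipschitzOnWith L w (Icc x y))
    (hae : ∀ᵐ t, t ∈ I → c * w t ^ 2 ≤ a t * (w t * deriv w t)) :
    ∀ y ∈ I, w y = 0 := by
  have hneg : LipschitzWith 1 (fun x : ℝ => -x) := LipschitzWith.id.neg
  have hconn : ((fun x : ℝ => -x) ⁻¹' I).OrdConnected :=
    ⟨fun x hx y hy z hz => hI_conn.out hy hx ⟨neg_le_neg hz.2, neg_le_neg hz.1⟩⟩
  have key := eq_zero_of_ae_deriv_le (I := (fun x : ℝ => -x) ⁻¹' I) (hI.preimage continuous_neg)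
    hconn (a := fun x => a (-x)) (w := fun x => w (-x)) (M := M) hκ hc
    (fun x => ha_range _) (by simpa [Function.comp_def] using ha_lip.comp hneg)
    (fun x hx => ha_pos _ hx)
    (fun x hx => ha_bdry _ (by
      have h := (Homeomorph.neg ℝ).preimage_frontier I
      have h' : x ∈ (Homeomorph.neg ℝ) ⁻¹' frontier I := by rw [h]; exact hx
      exact h'))
    (fun x hx => hM _ hx)
    (fun x hx y hy => by
      obtain ⟨L, hL⟩ := hw _ hy _ hx
      exact ⟨L * 1, hL.comp hneg.lipschitzOnWith
        (fun z hz => ⟨neg_le_neg hz.2, neg_le_neg hz.1⟩)⟩)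
    (by
      filter_upwards [(Measure.measurePreserving_neg volume).quasiMeasurePreserving.ae hae]
        with t ht hmem
      have := ht hmem
      rw [deriv_comp_neg (f := w)]
      linarith)
  intro y hy
  simpa using key (-y) (by simpa using hy)

lemma abs_deriv_le_of_isLocalMax_sub {u φ : ℝ → ℝ} {K : NNReal} {x₀ : ℝ} (hu : LipschitzWith K u)
    (hφ : DifferentiableAt ℝ φ x₀) (h : IsLocalMax (fun x => u x - φ x) x₀) :
    |deriv φ x₀| ≤ K := by
  have hs := hasDerivAt_iff_tendsto_slope.1 hφ.hasDerivAt
  have hb : ∀ᶠ x in 𝓝 x₀, -(K * |x - x₀|) ≤ φ x - φ x₀ := by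
    filter_upwards [h] with x hx
    have h1 := hu.dist_le_mul x x₀
    rw [Real.dist_eq, Real.dist_eq] at h1
    linarith [(abs_le.1 h1).1]
  rw [abs_le]
  constructor
  · have hs' : Tendsto (slope φ x₀) (𝓝[>] x₀) (𝓝 (deriv φ x₀)) :=
      hs.mono_left (nhdsWithin_mono _ fun x hx => ne_of_gt hx)
    apply ge_of_tendsto hs'
    filter_upwards [self_mem_nhdsWithin, nhdsWithin_le_nhds hb] with x hx hxb
    have hx' : 0 < x - x₀ := sub_pos.2 hx
    rw [abs_of_pos hx'] at hxb
    rw [slope_def_field, le_div_iff₀ hx']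
    linarith
  · have hs' : Tendsto (slope φ x₀) (𝓝[<] x₀) (𝓝 (deriv φ x₀)) :=
      hs.mono_left (nhdsWithin_mono _ fun x hx => ne_of_lt hx)
    apply le_of_tendsto hs'
    filter_upwards [self_mem_nhdsWithin, nhdsWithin_le_nhds hb] with x hx hxb
    have hx' : x - x₀ < 0 := sub_neg.2 hx
    rw [abs_of_neg hx'] at hxb
    rw [slope_def_field, div_le_iff_of_neg hx']
    linarith

lemma convexOn_add_sq_of_isLocalMax_sub {u : ℝ → ℝ} {c d C : ℝ} (hu : Continuous u)
    (h : ∀ x₀ ∈ Icc c d, ∀ φ : ℝ → ℝ, ContDiff ℝ 2 φ → IsLocalMax (fun x => u x - φ x) x₀ →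
      -C ≤ deriv (deriv φ) x₀) :
    ConvexOn ℝ (Icc c d) (fun x => u x + C / 2 * x ^ 2) := by
  apply LinearOrder.convexOn_of_lt (convex_Icc c d)
  intro x hx y hy hxy s t hs ht hst
  simp only [smul_eq_mul]
  set z := s * x + t * y with hz
  have hzx : z - x = t * (y - x) := by rw [hz]; linear_combination x * hst
  have hyz : y - z = s * (y - x) := by rw [hz]; linear_combination -y * hst
  have hyx : 0 < y - x := sub_pos.2 hxy
  have hzx0 : 0 < z - x := by rw [hzx]; positivity
  have hyz0 : 0 < y - z := by rw [hyz]; positivity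
  by_contra! hcon
  set A := u x + C / 2 * x ^ 2 with hA
  set D := u y + C / 2 * y ^ 2 with hD
  set B := (D - A) / (y - x) with hB
  have hBm : B * (y - x) = D - A := by rw [hB]; field_simp
  have hchord : A + B * (z - x) = s * A + t * D := by
    rw [hzx]; linear_combination t * hBm - A * hst
  set δ := u z + C / 2 * z ^ 2 - (s * A + t * D) with hδ
  have hδ0 : 0 < δ := sub_pos.2 hcon
  set ε := δ / (2 * ((z - x) * (y - z))) with hε
  have hε0 : 0 < ε := by positivity
  have hεm : ε * ((z - x) * (y - z)) = δ / 2 := by rw [hε]; field_simp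
  let q : ℝ → ℝ := fun r => A + B * (r - x) - C / 2 * r ^ 2 + ε * ((r - x) * (y - r))
  have hq1 : ∀ r, HasDerivAt q (B - C * r + ε * ((y - r) - (r - x))) r := by
    intro r
    have e1 := (hasDerivAt_id r).sub_const x
    have e2 := (hasDerivAt_id r).const_sub y
    have e3 := (((e1.const_mul B).const_add A).sub (((hasDerivAt_id r).pow 2).const_mul (C / 2))).add
      ((e1.mul e2).const_mul ε)
    refine HasDerivAt.congr_deriv e3 ?_
    simp
    ring
  have hq2 : ∀ r, deriv (deriv q) r = -C - 2 * ε := by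
    intro r
    have : deriv q = fun r => B - C * r + ε * ((y - r) - (r - x)) := funext fun r => (hq1 r).deriv
    rw [this]
    have e1 := (hasDerivAt_id r).sub_const x
    have e2 := (hasDerivAt_id r).const_sub y
    have e3 := (((hasDerivAt_id r).const_mul C).const_sub B).add ((e2.sub e1).const_mul ε)
    have := e3.deriv
    refine Eq.trans this ?_
    ring
  have hqc : ContDiff ℝ 2 q := by fun_prop
  obtain ⟨m, hm, hmax⟩ := (isCompact_Icc (a := x) (b := y)).exists_isMaxOn ⟨x, left_mem_Icc.2 hxy.le⟩
    ((hu.sub hqc.continuous).continuousOn)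
  have hzmem : z ∈ Icc x y := ⟨by linarith, by linarith⟩
  have hmz : 0 < u m - q m := by
    have h1 : u z - q z ≤ u m - q m := hmax hzmem
    have h2 : u z - q z = δ / 2 := by
      simp only [q]
      linarith
    linarith
  have hux : u x - q x = 0 := by simp only [q]; rw [hA]; ring
  have huy : u y - q y = 0 := by
    simp only [q]
    rw [hBm, hD]; ring
  have hm1 : x < m := lt_of_le_of_ne hm.1 (fun e => by rw [← e] at hmz; linarith)
  have hm2 : m < y := lt_of_le_of_ne hm.2 (fun e => by rw [e] at hmz; linarith)
  have := h m ⟨hx.1.trans hm.1, hm.2.trans hy.2⟩ q hqc (hmax.isLocalMax (Icc_mem_nhds hm1 hm2))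
  rw [hq2] at this
  linarith

lemma ConvexOn.differentiableAt_of_add_sq {u : ℝ → ℝ} {c d C x : ℝ} (hx : x ∈ Ioo c d)
    (h₁ : ConvexOn ℝ (Icc c d) (fun x => u x + C / 2 * x ^ 2))
    (h₂ : ConvexOn ℝ (Icc c d) (fun x => -u x + C / 2 * x ^ 2)) :
    DifferentiableAt ℝ u x := by
  have hx' : x ∈ interior (Icc c d) := by rwa [interior_Icc]
  have hr₁ := h₁.hasDerivWithinAt_rightDeriv_of_mem_interior hx'
  have hl₁ := h₁.hasDerivWithinAt_leftDeriv_of_mem_interior hx'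
  have hr₂ := h₂.hasDerivWithinAt_rightDeriv_of_mem_interior hx'
  have hl₂ := h₂.hasDerivWithinAt_leftDeriv_of_mem_interior hx'
  have i₁ := h₁.leftDeriv_le_rightDeriv_of_mem_interior hx'
  have i₂ := h₂.leftDeriv_le_rightDeriv_of_mem_interior hx'
  have hsq : HasDerivAt (fun x : ℝ => C / 2 * x ^ 2) (C / 2 * (2 * x)) x := by
    simpa using (hasDerivAt_pow 2 x).const_mul (C / 2)
  have hur := hr₁.sub hsq.hasDerivWithinAt
  have hul := hl₁.sub hsq.hasDerivWithinAt
  have hur' := (hr₂.sub hsq.hasDerivWithinAt).neg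
  have hul' := (hl₂.sub hsq.hasDerivWithinAt).neg
  have f₁ : ((fun x => u x + C / 2 * x ^ 2) - fun x : ℝ => C / 2 * x ^ 2) = u := by
    ext t; simp
  have f₂ : -((fun x => -u x + C / 2 * x ^ 2) - fun x : ℝ => C / 2 * x ^ 2) = u := by
    ext t; simp
  rw [f₁] at hur hul
  rw [f₂] at hur' hul'
  have er := (uniqueDiffWithinAt_Ioi x).eq_deriv _ hur hur'
  have el := (uniqueDiffWithinAt_Iio x).eq_deriv _ hul hul'
  have : HasDerivWithinAt u
      (derivWithin (fun x => u x + C / 2 * x ^ 2) (Iio x) x - C / 2 * (2 * x)) (Ioi x) x := by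
    have e := le_antisymm i₁ (by linarith)
    rwa [e]
  have hu := hul.union this
  rw [Iio_union_Ioi, compl_eq_univ_sdiff, hasDerivWithinAt_sdiff_singleton,
    hasDerivWithinAt_univ] at hu
  exact hu.differentiableAt

lemma ConvexOn.lipschitzOnWith_deriv_of_add_sq {u : ℝ → ℝ} {c d C : ℝ} (hC : 0 ≤ C)
    (h₁ : ConvexOn ℝ (Icc c d) (fun x => u x + C / 2 * x ^ 2))
    (h₂ : ConvexOn ℝ (Icc c d) (fun x => -u x + C / 2 * x ^ 2)) :
    LipschitzOnWith C.toNNReal (deriv u) (Ioo c d) := by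
  have hsq : ∀ x, HasDerivAt (fun x : ℝ => C / 2 * x ^ 2) (C / 2 * (2 * x)) x := fun x => by
    simpa using (hasDerivAt_pow 2 x).const_mul (C / 2)
  have hd : ∀ x ∈ Ioo c d, HasDerivAt u (deriv u x) x := fun x hx =>
    (ConvexOn.differentiableAt_of_add_sq hx h₁ h₂).hasDerivAt
  have hd₁ := fun x hx => (hd x hx).add (hsq x)
  have hd₂ := fun x hx => (hd x hx).neg.add (hsq x)
  have m₁ := (h₁.subset Ioo_subset_Icc_self (convex_Ioo c d)).monotoneOn_deriv
    (fun x hx => (hd₁ x hx).differentiableAt)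
  have m₂ := (h₂.subset Ioo_subset_Icc_self (convex_Ioo c d)).monotoneOn_deriv
    (fun x hx => (hd₂ x hx).differentiableAt)
  have key : ∀ x ∈ Ioo c d, ∀ y ∈ Ioo c d, x ≤ y → |deriv u x - deriv u y| ≤ C * |x - y| := by
    intro x hx y hy hxy
    have e₁ := m₁ hx hy hxy
    have e₂ := m₂ hx hy hxy
    have d1x := (hd₁ x hx).deriv
    have d1y := (hd₁ y hy).deriv
    have d2x := (hd₂ x hx).deriv
    have d2y := (hd₂ y hy).deriv
    erw [d1x, d1y] at e₁
    erw [d2x, d2y] at e₂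
    rw [abs_of_nonpos (sub_nonpos.2 hxy), abs_le]
    constructor <;> linarith
  apply LipschitzOnWith.of_dist_le_mul
  intro x hx y hy
  rw [Real.dist_eq, Real.dist_eq, Real.coe_toNNReal _ hC]
  rcases le_total x y with hxy | hxy
  · exact key x hx y hy hxy
  · rw [abs_sub_comm, abs_sub_comm x]; exact key y hy x hx hxy

section ViscositySolutions

variable {a V G u : ℝ → ℝ} {β lam : ℝ}

lemma le_of_viscSubsol_of_differentiableAt (h : IsViscSubsol a V G β lam u) {x : ℝ}
    (hax : 0 ≤ a x)
    (hu : ∀ᶠ y in 𝓝 x, DifferentiableAt ℝ u y) (hu' : DifferentiableAt ℝ (deriv u) x) :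
    lam ≤ a x * deriv (deriv u) x + G (deriv u x) + β * V x := by
  apply le_of_forall_pos_le_add
  intro ε hε
  by_contra! hcon
  set q := deriv (deriv u) x + ε / (a x + 1) with hq
  let φ : ℝ → ℝ := fun y => deriv u x * (y - x) + q / 2 * (y - x) ^ 2
  have hφ1 : ∀ y, HasDerivAt φ (deriv u x + q * (y - x)) y := by
    intro y
    have e1 := (hasDerivAt_id y).sub_const x
    refine ((e1.const_mul (deriv u x)).add ((e1.pow 2).const_mul (q / 2))).congr_deriv ?_
    simp
    ring
  have hφ1' : deriv φ = fun y => deriv u x + q * (y - x) := funext fun y => (hφ1 y).deriv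
  have hφ2 : ∀ y, HasDerivAt (deriv φ) q y := by
    intro y
    rw [hφ1']
    simpa using ((((hasDerivAt_id y).sub_const x).const_mul q).const_add (deriv u x))
  have hφc : ContDiff ℝ 2 φ := by fun_prop
  have hε' : 0 < ε / (a x + 1) := by positivity
  have hev : deriv (fun y => u y - φ y) =ᶠ[𝓝 x] fun y => deriv u y - deriv φ y := by
    filter_upwards [hu] with y hy
    exact (hy.hasDerivAt.sub (hφ1 y).differentiableAt.hasDerivAt).deriv
  have hmax : IsLocalMax (fun y => u y - φ y) x := by
    apply isLocalMax_of_deriv_deriv_neg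
    · have e := (hu'.hasDerivAt.sub (hφ2 x)).deriv
      rw [hev.deriv_eq]
      refine lt_of_eq_of_lt e ?_
      rw [hq]
      linarith
    · rw [hev.eq_of_nhds, hφ1']
      simp
    · exact hu.self_of_nhds.continuousAt.sub hφc.continuous.continuousAt
  have := h x φ hφc hmax
  rw [(hφ2 x).deriv, hφ1'] at this
  simp only [sub_self, mul_zero, add_zero] at this
  have h2 : a x * (ε / (a x + 1)) ≤ ε := by
    rw [mul_div_assoc', div_le_iff₀ (by linarith)]
    nlinarith
  rw [hq] at this
  linarith

lemma IsViscSupersol.neg (h : IsViscSupersol a V G β lam u) :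
    IsViscSubsol a (fun x => -V x) (fun p => -G (-p)) β (-lam) (fun x => -u x) := by
  intro x₀ φ hφ hmax
  have h1 := h x₀ (fun x => -φ x) hφ.neg (by
    have := hmax.neg
    refine this.congr (Eventually.of_forall fun x => ?_)
    simp only
    ring)
  have e1 : deriv (fun x => -φ x) = fun x => -deriv φ x := by ext x; simp
  rw [e1] at h1
  have e2 : deriv (fun x => -deriv φ x) x₀ = -deriv (deriv φ) x₀ := by simp
  rw [e2] at h1
  linarith

lemma eq_of_viscSol_of_differentiableAt (h : IsViscSol a V G β lam u) {x : ℝ}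
    (hax : 0 ≤ a x)
    (hu : ∀ᶠ y in 𝓝 x, DifferentiableAt ℝ u y) (hu' : DifferentiableAt ℝ (deriv u) x) :
    a x * deriv (deriv u) x + G (deriv u x) + β * V x = lam := by
  apply le_antisymm _ (le_of_viscSubsol_of_differentiableAt h.2.1 hax hu hu')
  have e1 : deriv (fun x => -u x) = fun x => -deriv u x := by ext x; simp
  have := le_of_viscSubsol_of_differentiableAt h.2.2.neg hax (hu.mono fun y hy => hy.neg)
    (by rw [e1]; exact hu'.neg)
  rw [e1] at this
  have e2 : deriv (fun x => -deriv u x) x = -deriv (deriv u) x := by simp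
  rw [e2, neg_neg] at this
  linarith

lemma convexOn_add_sq_of_viscSubsol {c d m M B C : ℝ} {K : NNReal}
    (hu : LipschitzWith K u) (hm : 0 < m) (ha : ∀ x ∈ Icc c d, m ≤ a x)
    (hG : ∀ p : ℝ, |p| ≤ K → G p ≤ M) (hV : ∀ x, β * V x ≤ B) (hC : 0 ≤ C)
    (hCm : M + B - lam ≤ C * m) (h : IsViscSubsol a V G β lam u) :
    ConvexOn ℝ (Icc c d) (fun x => u x + C / 2 * x ^ 2) := by
  apply convexOn_add_sq_of_isLocalMax_sub hu.continuous
  intro x₀ hx₀ φ hφ hmax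
  have h1 := h x₀ φ hφ hmax
  have h2 := hG _ (abs_deriv_le_of_isLocalMax_sub hu (hφ.differentiable (by norm_num) x₀) hmax)
  have h3 := hV x₀
  have h4 := ha x₀ hx₀
  by_contra! hcon
  nlinarith

lemma MemGclass.exists_abs_le (hG : MemGclass G) (R : ℝ) : ∃ M, ∀ p, |p| ≤ R → |G p| ≤ M := by
  obtain ⟨α₀, α₁, γ, h₀, h₁, hγ, hg, -⟩ := hG
  refine ⟨max (α₁ * (R ^ γ + 1)) (1 / α₀), fun p hp => abs_le.2 ⟨?_, ?_⟩⟩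
  · have := (hg p).1
    have : 0 ≤ α₀ * |p| ^ γ := by positivity
    linarith [le_max_right (α₁ * (R ^ γ + 1)) (1 / α₀)]
  · refine ((hg p).2.trans ?_).trans (le_max_left _ _)
    have := Real.rpow_le_rpow (abs_nonneg p) hp (by linarith : 0 ≤ γ)
    gcongr

lemma MemGclass.continuous (hG : MemGclass G) : Continuous G := by
  obtain ⟨α₀, α₁, γ, h₀, h₁, hγ, -, hg⟩ := hG
  rw [continuous_iff_continuousAt]
  intro p
  rw [ContinuousAt, tendsto_iff_dist_tendsto_zero]
  have hlim : Tendsto (fun q => α₁ * (|q| + |p| + 1) ^ (γ - 1) * |q - p|) (𝓝 p)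
      (𝓝 (α₁ * (|p| + |p| + 1) ^ (γ - 1) * |p - p|)) := by
    have : Continuous fun q : ℝ => α₁ * (|q| + |p| + 1) ^ (γ - 1) * |q - p| := by
      have : Continuous fun q : ℝ => (|q| + |p| + 1) ^ (γ - 1) :=
        (by fun_prop : Continuous fun q : ℝ => |q| + |p| + 1).rpow_const
          fun q => Or.inl (by positivity)
      fun_prop
    exact this.tendsto p
  rw [sub_self, abs_zero, mul_zero] at hlim
  exact squeeze_zero (fun q => dist_nonneg) (fun q => by rw [Real.dist_eq]; exact hg q p) hlim

lemma MemGsqc.gplusInv_nonneg (hG : MemGsqc G) {y : ℝ} (hy : 0 ≤ y) : 0 ≤ GplusInv G y := by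
  obtain ⟨hGc, h0, η, hη, hmono⟩ := hG
  suffices h : ∃ x ∈ Ici (0 : ℝ), G x = y from mem_Ici.1 (Function.invFunOn_mem h)
  rcases hy.eq_or_lt with rfl | hy
  · exact ⟨0, self_mem_Ici, h0⟩
  have hp : 0 < y / η := by positivity
  have h1 := (hmono 0 (y / η) le_rfl hp).1
  rw [h0, sub_zero, sub_zero, mul_div_cancel₀ _ hη.ne'] at h1
  obtain ⟨x, hx, hxy⟩ := intermediate_value_Icc hp.le hGc.continuous.continuousOn
    (by rw [h0]; exact ⟨hy.le, h1⟩ : y ∈ Icc (G 0) (G (y / η)))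
  exact ⟨x, hx.1, hxy⟩

lemma MemGsqc.gminusInv_nonpos (hG : MemGsqc G) {y : ℝ} (hy : 0 ≤ y) : GminusInv G y ≤ 0 := by
  obtain ⟨hGc, h0, η, hη, hmono⟩ := hG
  suffices h : ∃ x ∈ Iic (0 : ℝ), G x = y from mem_Iic.1 (Function.invFunOn_mem h)
  rcases hy.eq_or_lt with rfl | hy
  · exact ⟨0, self_mem_Iic, h0⟩
  have hp : 0 < y / η := by positivity
  have h1 := (hmono 0 (y / η) le_rfl hp).2
  rw [neg_zero, h0, sub_zero, sub_zero, mul_div_cancel₀ _ hη.ne'] at h1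
  obtain ⟨x, hx, hxy⟩ := intermediate_value_Icc' (neg_nonpos.2 hp.le) hGc.continuous.continuousOn
    (by rw [h0]; exact ⟨hy.le, h1⟩ : y ∈ Icc (G 0) (G (-(y / η))))
  exact ⟨x, hx.2, hxy⟩

lemma StrictIncrRate.mul_sq_le {η p q : ℝ} (h : StrictIncrRate G η) (hp : 0 ≤ p) (hq : 0 ≤ q) :
    η * (p - q) ^ 2 ≤ (p - q) * (G p - G q) := by
  rcases lt_trichotomy p q with hpq | rfl | hpq
  · nlinarith [(h p q hp hpq).1]
  · simp
  · nlinarith [(h q p hq hpq).1]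

lemma StrictIncrRate.mul_sq_le_of_nonpos {η p q : ℝ} (h : StrictIncrRate G η) (hp : p ≤ 0)
    (hq : q ≤ 0) : η * (p - q) ^ 2 ≤ -((p - q) * (G p - G q)) := by
  rcases lt_trichotomy p q with hpq | rfl | hpq
  · have := (h (-q) (-p) (by linarith) (by linarith)).2
    rw [neg_neg, neg_neg] at this
    nlinarith
  · simp
  · have := (h (-p) (-q) (by linarith) (by linarith)).2
    rw [neg_neg, neg_neg] at this
    nlinarith

lemma IsViscSol.regularity_Ioo {c d : ℝ} {K : NNReal} (hβ : 0 ≤ β) (hG : MemGclass G)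
    (ha : Continuous a) (ha_pos : ∀ x ∈ Icc c d, 0 < a x)
    (hV : ∀ x, V x ∈ Icc (0 : ℝ) 1) (hu : LipschitzWith K u) (h : IsViscSol a V G β lam u) :
    (∀ x ∈ Ioo c d, DifferentiableAt ℝ u x) ∧ ∃ L, LipschitzOnWith L (deriv u) (Ioo c d) := by
  rcases lt_or_ge d c with hdc | hcd
  · simp [Ioo_eq_empty (not_lt.2 hdc.le)]
  obtain ⟨x₀, hx₀, hmin⟩ := (isCompact_Icc (a := c) (b := d)).exists_isMinOn
    ⟨c, left_mem_Icc.2 hcd⟩ ha.continuousOn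
  have hm := ha_pos x₀ hx₀
  obtain ⟨M, hM⟩ := hG.exists_abs_le K
  have hM0 : 0 ≤ M := (abs_nonneg _).trans (hM 0 (by simp))
  set C := (M + β + |lam|) / a x₀ with hCdef
  have hC : 0 ≤ C := by positivity
  have hCm : C * a x₀ = M + β + |lam| := by rw [hCdef]; field_simp
  have h₁ : ConvexOn ℝ (Icc c d) (fun x => u x + C / 2 * x ^ 2) :=
    convexOn_add_sq_of_viscSubsol hu hm (fun x hx => hmin hx)
      (fun p hp => (abs_le.1 (hM p hp)).2) (B := β) (fun x => by nlinarith [(hV x).2]) hC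
      (by rw [hCm]; linarith [neg_abs_le lam]) h.2.1
  have h₂ : ConvexOn ℝ (Icc c d) (fun x => -u x + C / 2 * x ^ 2) :=
    convexOn_add_sq_of_viscSubsol hu.neg hm (fun x hx => hmin hx)
      (M := M) (fun p hp => by linarith [(abs_le.1 (hM (-p) (by rwa [abs_neg]))).1])
      (B := β) (fun x => by nlinarith [(hV x).1]) hC
      (by rw [hCm]; linarith [le_abs_self lam]) h.2.2.neg
  exact ⟨fun x hx => ConvexOn.differentiableAt_of_add_sq hx h₁ h₂, _,
    ConvexOn.lipschitzOnWith_deriv_of_add_sq hC h₁ h₂⟩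

lemma IsOpen.exists_lt_mem_and_gt_mem {I : Set ℝ} (hI : IsOpen I) {x : ℝ} (hx : x ∈ I) :
    (∃ c ∈ I, c < x) ∧ ∃ d ∈ I, x < d := by
  obtain ⟨l, r, ⟨hl, hr⟩, hsub⟩ := mem_nhds_iff_exists_Ioo_subset.1 (hI.mem_nhds hx)
  obtain ⟨c, hc⟩ := exists_between hl
  obtain ⟨d, hd⟩ := exists_between hr
  exact ⟨⟨c, hsub ⟨hc.1, hc.2.trans hr⟩, hc.2⟩, d, hsub ⟨hl.trans hd.1, hd.2⟩, hd.1⟩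

lemma IsViscSol.regularity {I : Set ℝ} (hI : IsOpen I) (hI_conn : I.OrdConnected)
    {K : NNReal} (hβ : 0 ≤ β) (hG : MemGclass G)
    (ha : Continuous a) (ha_pos : ∀ x ∈ I, 0 < a x)
    (hV : ∀ x, V x ∈ Icc (0 : ℝ) 1) (hu : LipschitzWith K u) (h : IsViscSol a V G β lam u) :
    (∀ x ∈ I, DifferentiableAt ℝ u x) ∧
      ∀ x ∈ I, ∀ y ∈ I, ∃ L, LipschitzOnWith L (deriv u) (Icc x y) := by
  have key : ∀ x ∈ I, ∀ y ∈ I, ∃ c d, c < x ∧ y < d ∧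
      (∀ x ∈ Ioo c d, DifferentiableAt ℝ u x) ∧ ∃ L, LipschitzOnWith L (deriv u) (Ioo c d) := by
    intro x hx y hy
    obtain ⟨⟨c, hc, hcx⟩, -⟩ := hI.exists_lt_mem_and_gt_mem hx
    obtain ⟨-, d, hd, hyd⟩ := hI.exists_lt_mem_and_gt_mem hy
    exact ⟨c, d, hcx, hyd,
      h.regularity_Ioo hβ hG ha (fun z hz => ha_pos z (hI_conn.out hc hd hz)) hV hu⟩
  constructor
  · intro x hx
    obtain ⟨c, d, hc, hd, hdiff, -⟩ := key x hx x hx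
    exact hdiff x ⟨hc, hd⟩
  · intro x hx y hy
    obtain ⟨c, d, hc, hd, -, L, hL⟩ := key x hx y hy
    exact ⟨L, hL.mono (Icc_subset_Ioo hc hd)⟩

lemma IsViscSol.ae_eq {I : Set ℝ} (hI : IsOpen I) (hI_conn : I.OrdConnected)
    {K : NNReal} (hβ : 0 ≤ β) (hG : MemGclass G)
    (ha : Continuous a) (ha_pos : ∀ x ∈ I, 0 < a x)
    (hV : ∀ x, V x ∈ Icc (0 : ℝ) 1) (hu : LipschitzWith K u) (h : IsViscSol a V G β lam u) :
    ∀ᵐ x, x ∈ I → DifferentiableAt ℝ (deriv u) x ∧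
      a x * deriv (deriv u) x + G (deriv u x) + β * V x = lam := by
  obtain ⟨hd, hL⟩ := h.regularity hI hI_conn hβ hG ha ha_pos hV hu
  apply ae_of_mem_of_ae_of_mem_inter_Ioo
  intro x y hx hy hxy
  obtain ⟨L, hL⟩ := hL x hx y hy
  have hac : AbsolutelyContinuousOnInterval (deriv u) x y :=
    LipschitzOnWith.absolutelyContinuousOnInterval (K := L) (by rwa [uIcc_of_le hxy.le])
  filter_upwards [hac.ae_differentiableAt] with t ht hmem
  have hdt := ht (by rw [uIcc_of_le hxy.le]; exact Ioo_subset_Icc_self hmem.2)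
  exact ⟨hdt, eq_of_viscSol_of_differentiableAt h (ha_pos t hmem.1).le
    (by filter_upwards [hI.mem_nhds hmem.1] with z hz using hd z hz) hdt⟩

end ViscositySolutions

theorem derivatives_agree_ae_on_nondegenerate_interval
    (β lam κ : ℝ) (hβ : 0 ≤ β) (hlam : β ≤ lam) (hκ : 0 < κ)
    (a V G : ℝ → ℝ)
    (ha_range : ∀ x, a x ∈ Set.Icc (0 : ℝ) 1)
    (ha_lip : LipschitzWith (Real.toNNReal κ) (fun x => Real.sqrt (a x)))
    (hV_range : ∀ x, V x ∈ Set.Icc (0 : ℝ) 1)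
    (hV_lip : LipschitzWith (Real.toNNReal κ) V)
    (hG : MemGsqc G)
    (I : Set ℝ) (hI_open : IsOpen I) (hI_conn : I.OrdConnected)
    (ha_pos : ∀ x ∈ I, 0 < a x)
    (ha_bdry : ∀ x ∈ frontier I, a x = 0)
    (u₁ u₂ : ℝ → ℝ)
    (hmem : (u₁ ∈ Splus a V G β lam ∧ u₂ ∈ Splus a V G β lam) ∨
            (u₁ ∈ Sminus a V G β lam ∧ u₂ ∈ Sminus a V G β lam)) :
    ∀ᵐ x ∂((volume : Measure ℝ).restrict I), deriv u₁ x = deriv u₂ x := by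
  have ha : Continuous a := by
    have : a = fun x => √(a x) ^ 2 := funext fun x => (Real.sq_sqrt (ha_range x).1).symm
    rw [this]
    exact ha_lip.continuous.pow 2
  obtain ⟨⟨K₁, hK₁⟩, hv₁⟩ : (∃ K, LipschitzWith K u₁) ∧ IsViscSol a V G β lam u₁ := by
    rcases hmem with h | h <;> exact ⟨h.1.1, h.1.2.1⟩
  obtain ⟨⟨K₂, hK₂⟩, hv₂⟩ : (∃ K, LipschitzWith K u₂) ∧ IsViscSol a V G β lam u₂ := by
    rcases hmem with h | h <;> exact ⟨h.2.1, h.2.2.1⟩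
  have hL₁ := (hv₁.regularity hI_open hI_conn hβ hG.1 ha ha_pos hV_range hK₁).2
  have hL₂ := (hv₂.regularity hI_open hI_conn hβ hG.1 ha ha_pos hV_range hK₂).2
  have hw : ∀ x ∈ I, ∀ y ∈ I, ∃ L,
      LipschitzOnWith L (fun x => deriv u₁ x - deriv u₂ x) (Icc x y) := by
    intro x hx y hy
    obtain ⟨L₁, h₁⟩ := hL₁ x hx y hy
    obtain ⟨L₂, h₂⟩ := hL₂ x hx y hy
    exact ⟨L₁ + L₂, h₁.sub h₂⟩
  have hM : ∀ x ∈ I, (deriv u₁ x - deriv u₂ x) ^ 2 ≤ ((K₁ : ℝ) + K₂) ^ 2 := by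
    intro x _
    have h₁ : |deriv u₁ x| ≤ K₁ := norm_deriv_le_of_lipschitz hK₁
    have h₂ : |deriv u₂ x| ≤ K₂ := norm_deriv_le_of_lipschitz hK₂
    apply sq_le_sq.2
    rw [abs_of_nonneg (by positivity : (0 : ℝ) ≤ K₁ + K₂)]
    exact (abs_sub _ _).trans (add_le_add h₁ h₂)
  have hae : ∀ᵐ x, x ∈ I →
      a x * ((deriv u₁ x - deriv u₂ x) * deriv (fun x => deriv u₁ x - deriv u₂ x) x) =
        -((deriv u₁ x - deriv u₂ x) * (G (deriv u₁ x) - G (deriv u₂ x))) := by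
    filter_upwards [hv₁.ae_eq hI_open hI_conn hβ hG.1 ha ha_pos hV_range hK₁,
      hv₂.ae_eq hI_open hI_conn hβ hG.1 ha ha_pos hV_range hK₂] with x h₁ h₂ hx
    obtain ⟨hd₁, e₁⟩ := h₁ hx
    obtain ⟨hd₂, e₂⟩ := h₂ hx
    rw [deriv_fun_sub hd₁ hd₂]
    linear_combination (deriv u₁ x - deriv u₂ x) * (e₁ - e₂)
  have hlb : 0 ≤ lam - β := sub_nonneg.2 hlam
  obtain ⟨η, hη, hmono⟩ := hG.2.2
  rw [ae_restrict_iff' hI_open.measurableSet]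
  refine Eventually.of_forall fun x hx => sub_eq_zero.1 ?_
  rcases hmem with ⟨h₁, h₂⟩ | ⟨h₁, h₂⟩
  · refine eq_zero_of_ae_deriv_le hI_open hI_conn hκ hη ha_range ha_lip ha_pos ha_bdry hM hw ?_ x hx
    filter_upwards [hae, h₁.2.2, h₂.2.2] with t ht hp hq hmem
    have h0 := hG.gplusInv_nonneg hlb
    rw [ht hmem]
    linarith [hmono.mul_sq_le (h0.trans hp.1) (h0.trans hq.1)]
  · refine eq_zero_of_ae_le_deriv hI_open hI_conn hκ hη ha_range ha_lip ha_pos ha_bdry hM hw ?_ x hx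
    filter_upwards [hae, h₁.2.2, h₂.2.2] with t ht hp hq hmem
    have h0 := hG.gminusInv_nonpos hlb
    rw [ht hmem]
    exact hmono.mul_sq_le_of_nonpos (hp.2.trans h0) (hq.2.trans h0)
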